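/- Let χ be a Dirichlet character of modulus N ≥ 1 with values in a commutative ℚ-algebra R, let n ≥ 1, and let F be a positive integer divisible by N. Then F^{n−1}·Σ_{a=1}^{F} χ(a)·B_n(a/F) = N^{n−1}·Σ_{a=1}^{N} χ(a)·B_n(a/N), where χ(a) is evaluated via reduction of a modulo N. That is, the generalized Bernoulli number B_{n,χ} may be computed using any multiple F of the modulus of χ. -/

import Mathlib

open Polynomial in
/-- The generalized Bernoulli number `B_{n,χ} = N^(n-1)·Σ_{a=1}^{N} χ(a)·B_n(a/N)` of a
Dirichlet character `χ` of modulus `N`, with values in a commutative `ℚ`-algebra. -/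
noncomputable def generalizedBernoulli {R : Type*} [CommRing R] [Algebra ℚ R] {N : ℕ}
    (χ : DirichletCharacter R N) (n : ℕ) : R :=
  (N : R) ^ (n - 1) *
    ∑ a ∈ Finset.range N,
      χ (((a + 1 : ℕ) : ZMod N)) *
        algebraMap ℚ R ((Polynomial.bernoulli n).eval (((a : ℚ) + 1) / N))

theorem raabe_aux_periodic (p : Polynomial ℚ) (h : ∀ x, p.eval (1 + x) = p.eval x) :
    Polynomial.derivative p = 0 := by
  have h2 : ∀ k : ℕ, p.eval (k : ℚ) = p.eval 0 := by
    intro k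
    induction k with
    | zero => simp
    | succ k ih => rw [← ih, ← h k]; push_cast; rw [add_comm]
  have : p = Polynomial.C (p.eval 0) := by
    apply Polynomial.eq_of_infinite_eval_eq
    apply (Set.infinite_range_of_injective (Nat.cast_injective (R := ℚ))).mono
    rintro _ ⟨k, rfl⟩
    simpa using h2 k
  rw [this, Polynomial.derivative_C]

noncomputable def raabeD (m n : ℕ) : Polynomial ℚ :=
  Polynomial.C ((m : ℚ) ^ n) * ∑ k ∈ Finset.range m,
    (Polynomial.bernoulli n).comp (Polynomial.C ((m : ℚ)⁻¹) * (Polynomial.X + Polynomial.C (k : ℚ)))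
    - Polynomial.C (m : ℚ) * Polynomial.bernoulli n

theorem raabeD_eval (m n : ℕ) (x : ℚ) : (raabeD m n).eval x =
    (m : ℚ) ^ n * ∑ k ∈ Finset.range m, (Polynomial.bernoulli n).eval ((x + k) / m)
      - m * (Polynomial.bernoulli n).eval x := by
  simp only [raabeD, Polynomial.eval_sub, Polynomial.eval_mul, Polynomial.eval_C,
    Polynomial.eval_finsetSum, Polynomial.eval_comp, Polynomial.eval_add, Polynomial.eval_X,
    div_eq_inv_mul]

theorem raabeD_deriv (m n : ℕ) (hm : 0 < m) : Polynomial.derivative (raabeD m (n + 1)) =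
    Polynomial.C ((n : ℚ) + 1) * raabeD m n := by
  have hm' : (m : ℚ) ≠ 0 := by positivity
  apply Polynomial.funext
  intro x
  rw [Polynomial.eval_mul, raabeD_eval]
  simp only [raabeD, Polynomial.derivative_sub, Polynomial.derivative_C_mul,
    Polynomial.derivative_sum, Polynomial.derivative_comp, Polynomial.derivative_bernoulli_add_one,
    Polynomial.derivative_add, Polynomial.derivative_X, Polynomial.derivative_C,
    Polynomial.eval_sub, Polynomial.eval_mul, Polynomial.eval_C,
    Polynomial.eval_finsetSum, Polynomial.eval_comp, Polynomial.eval_add, Polynomial.eval_X,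
    Polynomial.eval_natCast, Polynomial.eval_one, Polynomial.eval_zero, div_eq_inv_mul,
    ← Finset.mul_sum]
  field_simp
  ring

theorem raabeD_zero (m n : ℕ) (hm : 0 < m) : raabeD m n = 0 := by
  have hm' : (m : ℚ) ≠ 0 := by positivity
  have h1 : Polynomial.derivative (raabeD m (n + 1)) = 0 := by
    apply raabe_aux_periodic
    intro x
    rw [raabeD_eval, raabeD_eval, Polynomial.bernoulli_eval_one_add]
    have hs := Finset.sum_range_succ
      (fun k : ℕ => (Polynomial.bernoulli (n + 1)).eval ((x + k) / m)) m
    rw [Finset.sum_range_succ'] at hs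
    have e : (x + m) / m = 1 + x / m := by field_simp; ring
    simp only [e, Polynomial.bernoulli_eval_one_add, Nat.cast_zero, add_zero] at hs
    have e2 : ∀ k : ℕ, (1 + x + k) / m = (x + (k + 1 : ℕ)) / m := by
      intro k; push_cast; ring
    simp only [e2]
    rw [eq_sub_of_add_eq hs]
    simp only [Nat.add_sub_cancel, div_pow]
    field_simp
    ring
  rw [raabeD_deriv m n hm] at h1
  rcases mul_eq_zero.1 h1 with h | h
  · rw [Polynomial.C_eq_zero] at h
    exact absurd h (by positivity)
  · exact h

theorem raabe_mul (m n : ℕ) (hm : 0 < m) (hn : 1 ≤ n) (x : ℚ) :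
    (m : ℚ) ^ (n - 1) * ∑ k ∈ Finset.range m, (Polynomial.bernoulli n).eval ((x + k) / m)
      = (Polynomial.bernoulli n).eval x := by
  have hm' : (m : ℚ) ≠ 0 := by positivity
  have h := raabeD_eval m n x
  rw [raabeD_zero m n hm, Polynomial.eval_zero] at h
  obtain ⟨j, rfl⟩ := Nat.exists_eq_add_of_le' hn
  apply mul_left_cancel₀ hm'
  rw [Nat.add_sub_cancel]
  rw [pow_succ] at h
  linarith

theorem raabe_sum_range {R : Type*} [CommRing R] (f : ℕ → R) (N m : ℕ) :
    ∑ a ∈ Finset.range (N * m), f a =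
      ∑ a ∈ Finset.range N, ∑ k ∈ Finset.range m, f (N * k + a) := by
  rw [Finset.sum_comm]
  induction m with
  | zero => simp
  | succ m ih => rw [Nat.mul_succ, Finset.sum_range_add, ih, Finset.sum_range_succ]

/-- The generalized Bernoulli number `B_{n,χ}` may be computed using any positive
multiple `F` of the modulus `N` of `χ`:
`F^(n-1)·Σ_{a=1}^{F} χ(a)·B_n(a/F) = N^(n-1)·Σ_{a=1}^{N} χ(a)·B_n(a/N)`. -/
theorem generalizedBernoulli_eq_sum_over_multiple {R : Type*} [CommRing R] [Algebra ℚ R]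
    {N : ℕ} (hN : 1 ≤ N) (χ : DirichletCharacter R N) (n : ℕ) (hn : 1 ≤ n)
    (F : ℕ) (hF : 0 < F) (hNF : N ∣ F) :
    (F : R) ^ (n - 1) *
        ∑ a ∈ Finset.range F,
          χ (((a + 1 : ℕ) : ZMod N)) *
            algebraMap ℚ R ((Polynomial.bernoulli n).eval (((a : ℚ) + 1) / F)) =
      generalizedBernoulli χ n := by
  obtain ⟨m, rfl⟩ := hNF
  have hm : 0 < m := Nat.pos_of_mul_pos_left hF
  have hm' : (m : ℚ) ≠ 0 := by positivity
  have hN' : (N : ℚ) ≠ 0 := by positivity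
  rw [generalizedBernoulli, raabe_sum_range]
  push_cast
  rw [mul_pow, mul_assoc]
  congr 1
  rw [Finset.mul_sum]
  refine Finset.sum_congr rfl fun a _ => ?_
  rw [← raabe_mul m n hm hn (((a : ℚ) + 1) / N)]
  simp only [map_mul, map_pow, map_natCast, map_sum, Finset.mul_sum]
  refine Finset.sum_congr rfl fun k _ => ?_
  have e : ((N : ℚ) * k + a + 1) / (N * m) = (((a : ℚ) + 1) / N + k) / m := by
    field_simp
    ring
  rw [e]
  simp only [CharP.cast_eq_zero, zero_mul, zero_add]
  ring
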